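/- arXiv:math/0410078 — 4 statements merged into one kernel-verified Lean document; each statement's English description precedes it below -/
import Mathlib

section
/- Let N ≥ 3, let X ⊆ ℝ^N be a domain, let p > N/2, and let V : ℝ^N → ℝ be nonnegative and locally L^p-integrable on X. Let Ω ⊆ X be a domain admitting some smooth compactly supported function u₀ with support in Ω and ∫ V u₀² > 0, let B be an open set with compact closure contained in X, and let χ : ℝ^N → [0,1] be a smooth function with compact support contained in X that equals 1 on the closure of B. If (v_k) is a sequence of smooth functions with compact support contained in Ω ∪ B such that sup_k ∫ |∇v_k|² < ∞ and ∫_{supp χ} v_k² → 0, then liminf_{k→∞} ( ∫ |∇v_k|² − μ_Ω ∫ V v_k² ) ≥ 0. -/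
open MeasureTheory Filter Topology

/-- The Dirichlet energy `∫ |∇u|²` of a function on `ℝᴺ`. -/
noncomputable def grad2 (N : ℕ) (u : EuclideanSpace ℝ (Fin N) → ℝ) : ℝ :=
  ∫ x, ‖fderiv ℝ u x‖ ^ 2

/-- The weighted mass `∫ V u²`. -/
noncomputable def ven (N : ℕ) (V u : EuclideanSpace ℝ (Fin N) → ℝ) : ℝ :=
  ∫ x, V x * u x ^ 2

/-- A smooth test function with compact support contained in `Ω`. -/
def IsTest (N : ℕ) (Ω : Set (EuclideanSpace ℝ (Fin N)))
    (u : EuclideanSpace ℝ (Fin N) → ℝ) : Prop :=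
  ContDiff ℝ (⊤ : ℕ∞) u ∧ HasCompactSupport u ∧ tsupport u ⊆ Ω

/-- The Rayleigh quotient infimum `μ_Ω`. -/
noncomputable def mu (N : ℕ) (V : EuclideanSpace ℝ (Fin N) → ℝ)
    (Ω : Set (EuclideanSpace ℝ (Fin N))) : ℝ :=
  sInf {q : ℝ | ∃ u, IsTest N Ω u ∧ 0 < ven N V u ∧ q = grad2 N u / ven N V u}

/-- A normalized minimizing sequence for `μ_Ω`. -/
def MinimizingSeq (N : ℕ) (V : EuclideanSpace ℝ (Fin N) → ℝ)
    (Ω : Set (EuclideanSpace ℝ (Fin N)))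
    (u : ℕ → EuclideanSpace ℝ (Fin N) → ℝ) : Prop :=
  (∀ k, IsTest N Ω (u k)) ∧ (∀ k, ven N V (u k) = 1) ∧
    Tendsto (fun k => grad2 N (u k)) atTop (𝓝 (mu N V Ω))

/-- The gradients `∇u_k` form a Cauchy sequence in `L²(ℝᴺ; ℝᴺ)`. -/
def GradCauchy (N : ℕ) (u : ℕ → EuclideanSpace ℝ (Fin N) → ℝ) : Prop :=
  ∀ ε : ℝ, 0 < ε → ∃ M : ℕ, ∀ j ≥ M, ∀ l ≥ M,
    (∫ x, ‖fderiv ℝ (u j) x - fderiv ℝ (u l) x‖ ^ 2) < ε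

/-- `V` is locally `L^p` on `X`. -/
def LocLp (N : ℕ) (p : ℝ) (V : EuclideanSpace ℝ (Fin N) → ℝ)
    (X : Set (EuclideanSpace ℝ (Fin N))) : Prop :=
  ∀ K : Set (EuclideanSpace ℝ (Fin N)), IsCompact K → K ⊆ X →
    IntegrableOn (fun x => V x ^ p) K

/-- A pointwise interpolation inequality between the exponents `P` and `p`, with small constant
in front of the higher powers. -/
theorem exists_mul_le_add_rpow {P Q p δ : ℝ} (hPQ : P.HolderConjugate Q) (hp : P < p)
    (hδ : 0 < δ) :
    ∃ A, 0 ≤ A ∧ ∀ a b : ℝ, 0 ≤ a → 0 ≤ b → a * b ≤ A * b + δ * (a ^ p + b ^ Q) := by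
  have hP1 : 1 < P := hPQ.lt
  have hQ1 : 1 < Q := hPQ.symm.lt
  set l : ℝ := δ ^ (-Q⁻¹) with hl
  have hl0 : 0 < l := Real.rpow_pos_of_pos hδ _
  have hlQ : l⁻¹ ^ Q = δ := by
    rw [hl, ← Real.rpow_neg hδ.le, neg_neg, Real.rpow_inv_rpow hδ.le (by positivity)]
  have hc : 0 < l ^ P / δ := by positivity
  set A : ℝ := (l ^ P / δ) ^ (p - P)⁻¹ with hA
  have hA0 : 0 < A := Real.rpow_pos_of_pos hc _
  refine ⟨A, hA0.le, fun a b ha hb => ?_⟩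
  rcases le_or_gt a A with h | h
  · have : 0 ≤ δ * (a ^ p + b ^ Q) := by positivity
    nlinarith [mul_le_mul_of_nonneg_right h hb]
  · have ha' : 0 < a := hA0.trans h
    have hyoung := Real.young_inequality_of_nonneg (a := l * a) (b := l⁻¹ * b)
      (by positivity) (by positivity) hPQ
    have e1 : l * a * (l⁻¹ * b) = a * b := by field_simp
    have e2 : (l * a) ^ P ≤ δ * a ^ p := by
      have h3 : l ^ P / δ ≤ a ^ (p - P) := by
        calc l ^ P / δ = A ^ (p - P) := by
              rw [hA, Real.rpow_inv_rpow hc.le (by linarith)]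
          _ ≤ a ^ (p - P) := Real.rpow_le_rpow hA0.le h.le (by linarith)
      have h4 : a ^ p = a ^ (p - P) * a ^ P := by
        rw [← Real.rpow_add ha']; ring_nf
      rw [div_le_iff₀ hδ] at h3
      rw [Real.mul_rpow hl0.le ha, h4]
      nlinarith [mul_le_mul_of_nonneg_right h3 (Real.rpow_nonneg ha P)]
    have e3 : (l⁻¹ * b) ^ Q = δ * b ^ Q := by
      rw [Real.mul_rpow (by positivity) hb, hlQ]
    have e4 : (l * a) ^ P / P ≤ (l * a) ^ P :=
      div_le_self (by positivity) hP1.le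
    have e5 : (l⁻¹ * b) ^ Q / Q ≤ (l⁻¹ * b) ^ Q :=
      div_le_self (by positivity) hQ1.le
    have : 0 ≤ A * b := by positivity
    linarith

theorem ContDiff.integrable_norm_fderiv_sq {N : ℕ} {u : EuclideanSpace ℝ (Fin N) → ℝ}
    (hu : ContDiff ℝ 1 u) (hc : HasCompactSupport u) :
    Integrable (fun x => ‖fderiv ℝ u x‖ ^ 2) := by
  refine Continuous.integrable_of_hasCompactSupport ?_ ?_
  · exact ((hu.continuous_fderiv one_ne_zero).norm).pow 2
  · exact (hc.fderiv ℝ).comp_left (g := fun y => ‖y‖ ^ 2) (by simp)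

theorem HasCompactSupport.integrable_sq {N : ℕ} {u : EuclideanSpace ℝ (Fin N) → ℝ}
    (hc : HasCompactSupport u) (hu : Continuous u) : Integrable (fun x => u x ^ 2) := by
  refine Continuous.integrable_of_hasCompactSupport (hu.pow 2) ?_
  exact hc.comp_left (g := fun y : ℝ => y ^ 2) (by simp)

theorem HasCompactSupport.integrable_sq_rpow {N : ℕ} {u : EuclideanSpace ℝ (Fin N) → ℝ}
    {Q : ℝ} (hc : HasCompactSupport u) (hu : Continuous u) (hQ : 0 < Q) :
    Integrable (fun x => (u x ^ 2) ^ Q) := by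
  refine Continuous.integrable_of_hasCompactSupport
    ((hu.pow 2).rpow_const fun _ => Or.inr hQ.le) ?_
  exact hc.comp_left (g := fun y : ℝ => (y ^ 2) ^ Q) (by simp [Real.zero_rpow hQ.ne'])

theorem grad2_nonneg (N : ℕ) (u : EuclideanSpace ℝ (Fin N) → ℝ) : 0 ≤ grad2 N u :=
  integral_nonneg fun _ => by positivity

theorem ven_nonneg {N : ℕ} {V : EuclideanSpace ℝ (Fin N) → ℝ} (hV : ∀ x, 0 ≤ V x)
    (u : EuclideanSpace ℝ (Fin N) → ℝ) : 0 ≤ ven N V u :=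
  integral_nonneg fun x => mul_nonneg (hV x) (sq_nonneg _)

/-- The Sobolev inequality at the critical exponent `2Q = 2N / (N - 2)`. -/
theorem exists_integral_sq_rpow_le {N : ℕ} (hN : 0 < N) {Q : ℝ} (hQ : 0 < Q)
    (hQN : (2 * Q)⁻¹ = 2⁻¹ - (N : ℝ)⁻¹) :
    ∃ S : ℝ, 0 ≤ S ∧ ∀ u : EuclideanSpace ℝ (Fin N) → ℝ, ContDiff ℝ 1 u →
      HasCompactSupport u → ∫ x, (u x ^ 2) ^ Q ≤ S * grad2 N u ^ Q := by
  let q : NNReal := ⟨2 * Q, by positivity⟩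
  have hq : (q : ℝ) = 2 * Q := rfl
  have hq0 : q ≠ 0 := by
    rw [← NNReal.coe_ne_zero, hq]; positivity
  set C : NNReal :=
    eLpNormLESNormFDerivOfEqInnerConst (volume : Measure (EuclideanSpace ℝ (Fin N))) (2 : NNReal)
  refine ⟨(C : ℝ) ^ (2 * Q), by positivity, fun u hu hc => ?_⟩
  have hsob := eLpNorm_le_eLpNorm_fderiv_of_eq_inner (F' := ℝ)
    (volume : Measure (EuclideanSpace ℝ (Fin N))) hu hc (p := 2) (p' := q) (by norm_num)
    (by simpa using hN) (by simpa [hq] using hQN)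
  have hu' : MemLp u q := hu.continuous.memLp_of_hasCompactSupport hc
  have hd' : MemLp (fderiv ℝ u) (2 : NNReal) :=
    (hu.continuous_fderiv one_ne_zero).memLp_of_hasCompactSupport (hc.fderiv ℝ)
  have h1 := ENNReal.toReal_mono (ENNReal.mul_ne_top ENNReal.coe_ne_top hd'.eLpNorm_ne_top) hsob
  rw [ENNReal.toReal_mul, ENNReal.coe_toReal,
    hu'.eLpNorm_eq_integral_rpow_norm (by exact_mod_cast hq0) ENNReal.coe_ne_top,
    hd'.eLpNorm_eq_integral_rpow_norm (by norm_num) ENNReal.coe_ne_top,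
    ENNReal.toReal_ofReal (by positivity), ENNReal.toReal_ofReal (by positivity)] at h1
  have e1 : ∫ x, ‖u x‖ ^ ((q : ENNReal).toReal) = ∫ x, (u x ^ 2) ^ Q := by
    congr 1; ext x
    rw [ENNReal.coe_toReal, hq, Real.rpow_mul (norm_nonneg _)]
    simp
  have e2 : ∫ x, ‖fderiv ℝ u x‖ ^ (((2 : NNReal) : ENNReal).toReal) = grad2 N u := by
    simp [grad2]
  rw [e1, e2] at h1
  simp only [ENNReal.coe_toReal, hq] at h1
  have hI : 0 ≤ ∫ x, (u x ^ 2) ^ Q := integral_nonneg fun x => by positivity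
  have hG := grad2_nonneg N u
  have h2 := Real.rpow_le_rpow (by positivity) h1 (z := 2 * Q) (by positivity)
  rw [Real.rpow_inv_rpow hI (by positivity), Real.mul_rpow (by positivity) (by positivity),
    ← Real.rpow_mul hG] at h2
  refine h2.trans_eq ?_
  congr 2
  simp

theorem LocLp.integrableOn {N : ℕ} {p : ℝ} {V : EuclideanSpace ℝ (Fin N) → ℝ}
    {X K : Set (EuclideanSpace ℝ (Fin N))} (hV : LocLp N p V X) (hp : 1 ≤ p)
    (hV0 : ∀ x, 0 ≤ V x) (hK : IsCompact K) (hKX : K ⊆ X) : IntegrableOn V K := by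
  have h := hV K hK hKX
  have hp0 : p ≠ 0 := by positivity
  have hm : AEStronglyMeasurable V (volume.restrict K) := by
    have := (h.aestronglyMeasurable.aemeasurable.pow_const p⁻¹).aestronglyMeasurable
    refine this.congr (Eventually.of_forall fun x => ?_)
    exact Real.rpow_rpow_inv (hV0 x) hp0
  have h1 : IntegrableOn (fun x => 1 + V x ^ p) K :=
    (integrableOn_const hK.measure_lt_top.ne).add h
  refine Integrable.mono' h1 hm (Eventually.of_forall fun x => ?_)
  rw [Real.norm_of_nonneg (hV0 x)]
  rcases le_total (V x) 1 with hx | hx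
  · linarith [Real.rpow_nonneg (hV0 x) p]
  · linarith [Real.self_le_rpow_of_one_le hx hp]

theorem integrable_mul_sq {N : ℕ} {V u : EuclideanSpace ℝ (Fin N) → ℝ}
    (hV : IntegrableOn V (tsupport u)) (hu : Continuous u) (hc : HasCompactSupport u) :
    Integrable (fun x => V x * u x ^ 2) := by
  have h := hV.mul_continuousOn (g' := fun x => u x ^ 2) (hu.pow 2).continuousOn hc
  refine (integrableOn_iff_integrable_of_support_subset fun x hx => ?_).1 h
  refine subset_tsupport u fun h0 => hx ?_
  simp [h0]

/-- The Rayleigh quotient bound for test functions. -/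
theorem mu_mul_ven_le_grad2 {N : ℕ} {V u : EuclideanSpace ℝ (Fin N) → ℝ}
    {Ω : Set (EuclideanSpace ℝ (Fin N))} (hV0 : ∀ x, 0 ≤ V x) (hu : IsTest N Ω u) :
    mu N V Ω * ven N V u ≤ grad2 N u := by
  rcases (ven_nonneg hV0 u).eq_or_lt with h | h
  · rw [← h, mul_zero]; exact grad2_nonneg N u
  · rw [← le_div_iff₀ h]
    refine csInf_le ⟨0, ?_⟩ ⟨u, hu, h, rfl⟩
    rintro q ⟨w, -, hw, rfl⟩
    exact div_nonneg (grad2_nonneg N w) hw.le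

theorem mu_nonneg {N : ℕ} (V : EuclideanSpace ℝ (Fin N) → ℝ)
    (Ω : Set (EuclideanSpace ℝ (Fin N))) : 0 ≤ mu N V Ω := by
  refine Real.sInf_nonneg ?_
  rintro q ⟨w, -, hw, rfl⟩
  exact div_nonneg (grad2_nonneg N w) hw.le

/-- Cutting off a test function on `Ω ∪ B` near `B` gives a test function on `Ω`. -/
theorem IsTest.one_sub_mul {N : ℕ} {Ω B : Set (EuclideanSpace ℝ (Fin N))}
    {χ v : EuclideanSpace ℝ (Fin N) → ℝ} (hB : IsOpen B) (hχ : ContDiff ℝ (⊤ : ℕ∞) χ)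
    (hχB : ∀ x ∈ B, χ x = 1) (hv : IsTest N (Ω ∪ B) v) :
    IsTest N Ω (fun x => (1 - χ x) * v x) := by
  obtain ⟨hs, hc, ht⟩ := hv
  refine ⟨(contDiff_const.sub hχ).mul hs, hc.mul_left, fun x hx => ?_⟩
  rcases ht (tsupport_mul_subset_right hx) with h | h
  · exact h
  · exfalso
    obtain ⟨y, hyB, hy⟩ := mem_closure_iff.1 hx B hB h
    exact hy (by simp [hχB y hyB])

/-- Multiplication by `1 - χ` increases the Dirichlet energy at most slightly, up to
a multiple of the mass on the support of `χ`. -/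
theorem grad2_one_sub_mul_le {N : ℕ} {χ v : EuclideanSpace ℝ (Fin N) → ℝ} {M δ : ℝ}
    (hχ : ContDiff ℝ 1 χ) (hχ01 : ∀ x, χ x ∈ Set.Icc (0 : ℝ) 1)
    (hM : ∀ x, ‖fderiv ℝ χ x‖ ≤ M) (hv : ContDiff ℝ 1 v) (hc : HasCompactSupport v)
    (hδ : 0 < δ) :
    grad2 N (fun x => (1 - χ x) * v x) ≤
      (1 + δ) * grad2 N v + (1 + δ⁻¹) * M ^ 2 * ∫ x in tsupport χ, v x ^ 2 := by
  have hM0 : 0 ≤ M := (norm_nonneg _).trans (hM 0)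
  have hK : MeasurableSet (tsupport χ) := (isClosed_tsupport χ).measurableSet
  have hi1 : Integrable (fun x => (1 + δ) * ‖fderiv ℝ v x‖ ^ 2) :=
    (hv.integrable_norm_fderiv_sq hc).const_mul _
  have hi2 : Integrable (fun x => (1 + δ⁻¹) * M ^ 2 *
      (tsupport χ).indicator (fun x => v x ^ 2) x) :=
    ((hc.integrable_sq hv.continuous).indicator hK).const_mul _
  rw [grad2, grad2, ← integral_indicator hK, ← integral_const_mul, ← integral_const_mul,
    ← integral_add hi1 hi2]
  refine integral_mono (((contDiff_const.sub hχ).mul hv).integrable_norm_fderiv_sq hc.mul_left)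
    (hi1.add hi2) fun x => ?_
  have hd : fderiv ℝ (fun x => (1 - χ x) * v x) x =
      (1 - χ x) • fderiv ℝ v x - v x • fderiv ℝ χ x := by
    have h1 : DifferentiableAt ℝ χ x := hχ.differentiable one_ne_zero x
    have h2 : DifferentiableAt ℝ v x := hv.differentiable one_ne_zero x
    have := ((h1.hasFDerivAt.const_sub 1).mul h2.hasFDerivAt).fderiv
    refine this.trans ?_
    rw [smul_neg, ← sub_eq_add_neg]
  obtain ⟨hx0, hx1⟩ := hχ01 x
  have hn : ‖fderiv ℝ (fun x => (1 - χ x) * v x) x‖ ≤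
      ‖fderiv ℝ v x‖ + |v x| * ‖fderiv ℝ χ x‖ := by
    rw [hd]
    refine (norm_sub_le _ _).trans ?_
    rw [norm_smul, norm_smul, Real.norm_eq_abs, Real.norm_eq_abs, abs_of_nonneg (by linarith)]
    nlinarith [norm_nonneg (fderiv ℝ v x)]
  have hb : (|v x| * ‖fderiv ℝ χ x‖) ^ 2 ≤
      M ^ 2 * (tsupport χ).indicator (fun x => v x ^ 2) x := by
    by_cases hx : x ∈ tsupport χ
    · rw [Set.indicator_of_mem hx, mul_pow, sq_abs, mul_comm]
      have := hM x
      gcongr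
    · have : fderiv ℝ χ x = 0 := by
        by_contra h0
        exact hx (support_fderiv_subset ℝ h0)
      simp [this, hx]
  set a := ‖fderiv ℝ v x‖
  set b := |v x| * ‖fderiv ℝ χ x‖
  have hyoung : (a + b) ^ 2 ≤ (1 + δ) * a ^ 2 + (1 + δ⁻¹) * b ^ 2 := by
    have : (1 + δ) * a ^ 2 + (1 + δ⁻¹) * b ^ 2 - (a + b) ^ 2 = δ⁻¹ * (δ * a - b) ^ 2 := by
      field_simp
      ring
    have : 0 ≤ δ⁻¹ * (δ * a - b) ^ 2 := by positivity
    linarith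
  calc ‖fderiv ℝ (fun x => (1 - χ x) * v x) x‖ ^ 2 ≤ (a + b) ^ 2 := by gcongr
    _ ≤ (1 + δ) * a ^ 2 + (1 + δ⁻¹) * b ^ 2 := hyoung
    _ ≤ (1 + δ) * a ^ 2 + (1 + δ⁻¹) * (M ^ 2 *
        (tsupport χ).indicator (fun x => v x ^ 2) x) := by gcongr
    _ = _ := by ring

/-- The weighted mass changes under multiplication by `1 - χ` by at most the weighted mass on
the support of `χ`. -/
theorem ven_le_ven_one_sub_mul_add {N : ℕ} {V χ v : EuclideanSpace ℝ (Fin N) → ℝ}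
    (hV0 : ∀ x, 0 ≤ V x) (hV : IntegrableOn V (tsupport v)) (hχ : Continuous χ)
    (hv : Continuous v) (hc : HasCompactSupport v) :
    ven N V v ≤ ven N V (fun x => (1 - χ x) * v x) + ∫ x in tsupport χ, V x * v x ^ 2 := by
  have hK : MeasurableSet (tsupport χ) := (isClosed_tsupport χ).measurableSet
  have hi := integrable_mul_sq hV hv hc
  have hiw : Integrable (fun x => V x * ((1 - χ x) * v x) ^ 2) :=
    integrable_mul_sq (hV.mono_set tsupport_mul_subset_right)
      ((continuous_const.sub hχ).mul hv) hc.mul_left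
  rw [ven, ven, ← integral_indicator hK, ← integral_add hiw (hi.indicator hK)]
  refine integral_mono hi (hiw.add (hi.indicator hK)) fun x => ?_
  by_cases hx : x ∈ tsupport χ
  · have : 0 ≤ V x * ((1 - χ x) * v x) ^ 2 := mul_nonneg (hV0 x) (sq_nonneg _)
    simpa [hx] using this
  · simp [hx, image_eq_zero_of_notMem_tsupport hx]

/-- If the Dirichlet energies stay bounded and the masses on a compact set `K` vanish, so do
the weighted masses on `K`. -/
theorem tendsto_setIntegral_mul_sq {N : ℕ} (hN : 3 ≤ N) {p : ℝ} (hp : (N : ℝ) / 2 < p)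
    {V : EuclideanSpace ℝ (Fin N) → ℝ} (hV0 : ∀ x, 0 ≤ V x)
    {K : Set (EuclideanSpace ℝ (Fin N))} (hVp : IntegrableOn (fun x => V x ^ p) K)
    (v : ℕ → EuclideanSpace ℝ (Fin N) → ℝ) (hv : ∀ k, ContDiff ℝ 1 (v k))
    (hc : ∀ k, HasCompactSupport (v k)) {C : ℝ} (hbd : ∀ k, grad2 N (v k) ≤ C)
    (hvanish : Tendsto (fun k => ∫ x in K, (v k x) ^ 2) atTop (𝓝 0)) :
    Tendsto (fun k => ∫ x in K, V x * (v k x) ^ 2) atTop (𝓝 0) := by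
  have hN' : (3 : ℝ) ≤ N := by exact_mod_cast hN
  have hPQ : ((N : ℝ) / 2).HolderConjugate ((N : ℝ) / (N - 2)) := by
    rw [Real.holderConjugate_iff]
    refine ⟨by linarith, ?_⟩
    have : (N : ℝ) - 2 ≠ 0 := by linarith
    field_simp
    ring
  have hQ : 0 < (N : ℝ) / (N - 2) := hPQ.symm.pos
  obtain ⟨S, hS0, hS⟩ := exists_integral_sq_rpow_le (N := N) (by omega) hQ (by
    have : (N : ℝ) - 2 ≠ 0 := by linarith
    field_simp)
  set Q : ℝ := (N : ℝ) / (N - 2)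
  set T : ℝ := ∫ x in K, V x ^ p
  set D : ℝ := T + S * C ^ Q
  have hC0 : 0 ≤ C := (grad2_nonneg N (v 0)).trans (hbd 0)
  have hD0 : 0 ≤ D :=
    add_nonneg (integral_nonneg fun x => Real.rpow_nonneg (hV0 x) p) (by positivity)
  rw [Metric.tendsto_atTop'] at hvanish ⊢
  intro ε hε
  obtain ⟨A, hA0, hA⟩ := exists_mul_le_add_rpow hPQ hp (δ := ε / (2 * (D + 1))) (by positivity)
  set δ : ℝ := ε / (2 * (D + 1)) with hδ
  have hδ0 : 0 < δ := by positivity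
  have hδD : δ * D < ε / 2 := by
    rw [hδ, div_mul_eq_mul_div, div_lt_div_iff₀ (by positivity) (by positivity)]
    nlinarith
  obtain ⟨n, hn⟩ := hvanish (ε / (2 * (A + 1))) (by positivity)
  refine ⟨n, fun k hk => ?_⟩
  have hmass := hn k hk
  have hm0 : 0 ≤ ∫ x in K, (v k x) ^ 2 := integral_nonneg fun x => sq_nonneg _
  rw [Real.dist_0_eq_abs, abs_of_nonneg hm0, lt_div_iff₀ (by positivity)] at hmass
  rw [Real.dist_0_eq_abs, abs_of_nonneg
    (integral_nonneg fun x => mul_nonneg (hV0 x) (sq_nonneg _))]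
  have hi1 : IntegrableOn (fun x => A * v k x ^ 2) K :=
    (((hc k).integrable_sq (hv k).continuous).const_mul A).integrableOn
  have hi3 : Integrable (fun x => (v k x ^ 2) ^ Q) :=
    (hc k).integrable_sq_rpow (hv k).continuous hQ
  have hi2 : IntegrableOn (fun x => δ * (V x ^ p + (v k x ^ 2) ^ Q)) K :=
    (hVp.add hi3.integrableOn).const_mul δ
  have hsob : ∫ x in K, (v k x ^ 2) ^ Q ≤ S * C ^ Q := by
    refine (setIntegral_le_integral hi3 (Eventually.of_forall fun x => ?_)).trans
      ((hS (v k) (hv k) (hc k)).trans ?_)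
    · exact Real.rpow_nonneg (sq_nonneg _) _
    · exact mul_le_mul_of_nonneg_left
        (Real.rpow_le_rpow (grad2_nonneg N (v k)) (hbd k) hQ.le) hS0
  calc ∫ x in K, V x * v k x ^ 2
      ≤ ∫ x in K, (A * v k x ^ 2 + δ * (V x ^ p + (v k x ^ 2) ^ Q)) :=
        integral_mono_of_nonneg
          (Eventually.of_forall fun x => mul_nonneg (hV0 x) (sq_nonneg _)) (Integrable.add hi1 hi2)
          (Eventually.of_forall fun x => hA _ _ (hV0 x) (sq_nonneg _))
    _ = A * (∫ x in K, v k x ^ 2) + δ * (T + ∫ x in K, (v k x ^ 2) ^ Q) := by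
        rw [integral_add hi1 hi2, integral_const_mul, integral_const_mul,
          integral_add hVp hi3.integrableOn]
    _ ≤ A * (∫ x in K, v k x ^ 2) + δ * D := by
        have : T + ∫ x in K, (v k x ^ 2) ^ Q ≤ D := by
          simpa only [D] using add_le_add_right hsob T
        gcongr
    _ < ε := by nlinarith

/-- **Inequality (2.4) of Pinchover–Tintarev.** For a sequence `v_k` supported in `Ω ∪ B`
with bounded Dirichlet energy whose mass on `supp χ` vanishes,
`liminf (∫|∇v_k|² − μ_Ω ∫ V v_k²) ≥ 0` (stated via: for every `ε > 0`, eventually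
`∫|∇v_k|² − μ_Ω ∫ V v_k² > −ε`). -/
theorem energy_of_vanishing_part_almost_dominated
    (N : ℕ) (hN : 3 ≤ N) (p : ℝ) (hp : (N : ℝ) / 2 < p)
    (X : Set (EuclideanSpace ℝ (Fin N))) (hXop : IsOpen X) (hXconn : IsConnected X)
    (V : EuclideanSpace ℝ (Fin N) → ℝ) (hV0 : ∀ x, 0 ≤ V x) (hVloc : LocLp N p V X)
    (Ω : Set (EuclideanSpace ℝ (Fin N))) (hΩop : IsOpen Ω) (hΩconn : IsConnected Ω)
    (hΩX : Ω ⊆ X)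
    (hne : ∃ u₀, IsTest N Ω u₀ ∧ 0 < ven N V u₀)
    (B : Set (EuclideanSpace ℝ (Fin N))) (hBop : IsOpen B)
    (hBcp : IsCompact (closure B)) (hBX : closure B ⊆ X)
    (χ : EuclideanSpace ℝ (Fin N) → ℝ) (hχsm : ContDiff ℝ (⊤ : ℕ∞) χ)
    (hχcs : HasCompactSupport χ) (hχX : tsupport χ ⊆ X)
    (hχ01 : ∀ x, χ x ∈ Set.Icc (0 : ℝ) 1) (hχB : ∀ x ∈ closure B, χ x = 1)
    (v : ℕ → EuclideanSpace ℝ (Fin N) → ℝ) (hv : ∀ k, IsTest N (Ω ∪ B) (v k))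
    (hbd : ∃ C : ℝ, ∀ k, grad2 N (v k) ≤ C)
    (hvanish : Tendsto (fun k => ∫ x in tsupport χ, (v k x) ^ 2) atTop (𝓝 0)) :
    ∀ ε : ℝ, 0 < ε → ∀ᶠ k in atTop,
      -ε < grad2 N (v k) - mu N V Ω * ven N V (v k) := by
  intro ε hε
  obtain ⟨C, hC⟩ := hbd
  have hN' : (3 : ℝ) ≤ N := by exact_mod_cast hN
  have hC0 : 0 ≤ C := (grad2_nonneg N (v 0)).trans (hC 0)
  have hle : (1 : WithTop ℕ∞) ≤ ((⊤ : ℕ∞) : WithTop ℕ∞) := by exact_mod_cast le_top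
  have hχ1 : ContDiff ℝ 1 χ := hχsm.of_le hle
  have hv1 : ∀ k, ContDiff ℝ 1 (v k) := fun k => (hv k).1.of_le hle
  obtain ⟨M, hM⟩ := (hχ1.continuous_fderiv one_ne_zero).bounded_above_of_compact_support
    (hχcs.fderiv ℝ)
  have hVvanish := tendsto_setIntegral_mul_sq hN hp hV0 (hVloc _ hχcs hχX) v hv1
    (fun k => (hv k).2.1) hC hvanish
  set δ : ℝ := ε / (2 * (C + 1)) with hδ
  have hδ0 : 0 < δ := by positivity
  have hδC : δ * C < ε / 2 := by
    rw [hδ, div_mul_eq_mul_div, div_lt_div_iff₀ (by positivity) (by positivity)]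
    nlinarith
  have hlim : Tendsto (fun k => (1 + δ⁻¹) * M ^ 2 * (∫ x in tsupport χ, (v k x) ^ 2) +
      mu N V Ω * ∫ x in tsupport χ, V x * (v k x) ^ 2) atTop (𝓝 0) := by
    simpa using (hvanish.const_mul ((1 + δ⁻¹) * M ^ 2)).add (hVvanish.const_mul (mu N V Ω))
  filter_upwards [hlim.eventually_lt_const (half_pos hε)] with k hk
  have htX : tsupport (v k) ⊆ X :=
    (hv k).2.2.trans (Set.union_subset hΩX (subset_closure.trans hBX))
  have hVi : IntegrableOn V (tsupport (v k)) :=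
    hVloc.integrableOn (by linarith) hV0 (hv k).2.1 htX
  have h1 := mu_mul_ven_le_grad2 hV0
    ((hv k).one_sub_mul hBop hχsm fun x hx => hχB x (subset_closure hx))
  have h2 := grad2_one_sub_mul_le hχ1 hχ01 hM (hv1 k) (hv k).2.1 hδ0
  have h3 := mul_le_mul_of_nonneg_left (ven_le_ven_one_sub_mul_add hV0 hVi hχ1.continuous
    (hv1 k).continuous (hv k).2.1) (mu_nonneg V Ω)
  have h4 := mul_le_mul_of_nonneg_left (hC k) hδ0.le
  linarith
end

section
/- Let N ≥ 3. For every smooth function u : ℝ^N → ℝ, not identically zero, with compact support contained in ℝ^N \ {0}, the Hardy inequality is strict: ((N−2)²/4) ∫_{ℝ^N} u(x)²/|x|² dx < ∫_{ℝ^N} |∇u(x)|² dx. -/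
open MeasureTheory Filter Topology

open scoped Gradient

lemma contDiff_div_norm_sq {E : Type*} [NormedAddCommGroup E] [InnerProductSpace ℝ E]
    {n : WithTop ℕ∞} {f : E → ℝ} (hf : ContDiff ℝ n f) (h0 : (0 : E) ∉ tsupport f) :
    ContDiff ℝ n fun x => f x / ‖x‖ ^ 2 := by
  rw [contDiff_iff_contDiffAt]
  intro x
  rcases eq_or_ne x 0 with rfl | hx
  · have h : (fun x => f x / ‖x‖ ^ 2) =ᶠ[𝓝 0] fun _ => 0 := by
      filter_upwards [notMem_tsupport_iff_eventuallyEq.mp h0] with y hy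
      simp [hy]
    exact contDiffAt_const.congr_of_eventuallyEq h
  · exact hf.contDiffAt.div (contDiff_norm_sq ℝ).contDiffAt (by simpa using hx)

/-- Integration by parts against the Euler vector field. -/
lemma integral_fderiv_apply_self {N : ℕ} {w : EuclideanSpace ℝ (Fin N) → ℝ}
    (hw : ContDiff ℝ 1 w) (hc : HasCompactSupport w) :
    ∫ x, fderiv ℝ w x x = -(N * ∫ x, w x) := by
  let e : Fin N → EuclideanSpace ℝ (Fin N) := fun i => EuclideanSpace.single i 1
  have hcont (i) : Continuous fun x => fderiv ℝ w x (e i) :=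
    (hw.continuous_fderiv one_ne_zero).clm_apply continuous_const
  have hint (i) : Integrable fun x => x i * fderiv ℝ w x (e i) :=
    ((by fun_prop : Continuous fun x : EuclideanSpace ℝ (Fin N) => x i).mul
      (hcont i)).integrable_of_hasCompactSupport ((hc.fderiv_apply ℝ (e i)).mul_left)
  have hcoord (i : Fin N) (x : EuclideanSpace ℝ (Fin N)) :
      fderiv ℝ (fun y : EuclideanSpace ℝ (Fin N) => y i) x (e i) = 1 := by
    have : HasFDerivAt (fun y : EuclideanSpace ℝ (Fin N) => y i)
        (EuclideanSpace.proj i : EuclideanSpace ℝ (Fin N) →L[ℝ] ℝ) x :=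
      (EuclideanSpace.proj i : EuclideanSpace ℝ (Fin N) →L[ℝ] ℝ).hasFDerivAt
    rw [this.fderiv]
    simp [e]
  have hparts (i) : ∫ x, x i * fderiv ℝ w x (e i) = -∫ x, w x := by
    rw [integral_mul_fderiv_eq_neg_fderiv_mul_of_integrable]
    · simp_rw [hcoord, one_mul]
    · simpa only [hcoord, one_mul] using hw.continuous.integrable_of_hasCompactSupport hc
    · exact hint i
    · exact ((by fun_prop : Continuous fun x : EuclideanSpace ℝ (Fin N) => x i).mul
        hw.continuous).integrable_of_hasCompactSupport hc.mul_left
    · exact fun x _ => by fun_prop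
    · exact fun x _ => (hw.differentiable one_ne_zero).differentiableAt
  have hsum (x : EuclideanSpace ℝ (Fin N)) :
      fderiv ℝ w x x = ∑ i, x i * fderiv ℝ w x (e i) := by
    have h := congrArg (fderiv ℝ w x) ((EuclideanSpace.basisFun (Fin N) ℝ).sum_repr x).symm
    simpa only [EuclideanSpace.basisFun_repr, EuclideanSpace.basisFun_apply, map_sum, map_smul,
      smul_eq_mul] using h
  simp_rw [hsum]
  rw [integral_finsetSum _ fun i _ => hint i]
  simp [hparts]

lemma fderiv_sq_div_norm_sq_apply_self {E : Type*} [NormedAddCommGroup E]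
    [InnerProductSpace ℝ E] {u : E → ℝ} {x : E} (hu : DifferentiableAt ℝ u x)
    (hw : DifferentiableAt ℝ (fun x => u x ^ 2 / ‖x‖ ^ 2) x) :
    fderiv ℝ (fun x => u x ^ 2 / ‖x‖ ^ 2) x x =
      2 * (u x / ‖x‖ ^ 2 * fderiv ℝ u x x) - 2 * (u x ^ 2 / ‖x‖ ^ 2) := by
  rcases eq_or_ne x 0 with rfl | hx
  · simp
  have hx' : ‖x‖ ^ 2 ≠ 0 := by simpa using hx
  have h1 := hw.hasFDerivAt.mul (hasStrictFDerivAt_norm_sq x).hasFDerivAt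
  have h2 : HasFDerivAt (fun y => u y ^ 2 / ‖y‖ ^ 2 * ‖y‖ ^ 2) _ x :=
    (hu.hasFDerivAt.pow 2).congr_of_eventuallyEq <| by
      filter_upwards [isOpen_ne.mem_nhds hx] with y hy
      have : ‖y‖ ^ 2 ≠ 0 := by simpa using hy
      simp [div_mul_cancel₀ _ this]
  have h3 := congrArg (fun L : E →L[ℝ] ℝ => L x) (h1.unique h2)
  simp at h3
  field_simp at h3 ⊢
  linarith

lemma exists_ne_zero_fderiv_eq_zero {E : Type*} [NormedAddCommGroup E] [NormedSpace ℝ E]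
    {u : E → ℝ} (hd : Differentiable ℝ u) (hcs : HasCompactSupport u) (hu : u ≠ 0) :
    ∃ x, u x ≠ 0 ∧ fderiv ℝ u x = 0 := by
  obtain ⟨y, hy⟩ := Function.ne_iff.mp hu
  obtain ⟨x, hx⟩ := (hd.continuous.pow 2).exists_forall_ge_of_hasCompactSupport
    (hcs.mono (f' := u ^ 2) fun z hz h => hz (by simp [h]))
  have hux : u x ≠ 0 := fun h => by
    have h1 : u y ^ 2 ≤ u x ^ 2 := hx y
    simp [h] at h1
    exact hy h1
  refine ⟨x, hux, ?_⟩
  have hmax : IsLocalMax (fun z => u z ^ 2) x := Filter.Eventually.of_forall hx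
  have h := hmax.hasFDerivAt_eq_zero ((hd x).hasFDerivAt.pow 2)
  simpa [hux] using h

/-- **Strict Hardy inequality.** For `N ≥ 3` and every nonzero smooth `u` compactly
supported away from the origin, `((N−2)²/4) ∫ u²/|x|² < ∫ |∇u|²`. -/
theorem hardy_inequality_strict
    (N : ℕ) (hN : 3 ≤ N) (u : EuclideanSpace ℝ (Fin N) → ℝ)
    (hsm : ContDiff ℝ (⊤ : ℕ∞) u) (hcs : HasCompactSupport u)
    (hsupp : tsupport u ⊆ {x : EuclideanSpace ℝ (Fin N) | x ≠ 0}) (hu : u ≠ 0) :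
    ((N : ℝ) - 2) ^ 2 / 4 * ∫ x, u x ^ 2 / ‖x‖ ^ 2 < ∫ x, ‖fderiv ℝ u x‖ ^ 2 := by
  have h0 : (0 : EuclideanSpace ℝ (Fin N)) ∉ tsupport u := fun h => hsupp h rfl
  have hu1 : ContDiff ℝ 1 u := hsm.of_le (by exact_mod_cast le_top)
  have hd : Differentiable ℝ u := hu1.differentiable one_ne_zero
  have hq : Continuous fun x => u x / ‖x‖ ^ 2 := (contDiff_div_norm_sq hu1 h0).continuous
  have hw : ContDiff ℝ 1 fun x => u x ^ 2 / ‖x‖ ^ 2 :=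
    contDiff_div_norm_sq (hu1.pow 2) fun h => h0 <|
      closure_mono (fun x (hx : u x ^ 2 ≠ 0) => by simpa using hx) h
  have hwc : HasCompactSupport fun x => u x ^ 2 / ‖x‖ ^ 2 :=
    hcs.mono fun x (hx : u x ^ 2 / ‖x‖ ^ 2 ≠ 0) h => hx (by simp [h])
  have hDu : Continuous (fderiv ℝ u) := hu1.continuous_fderiv one_ne_zero
  have hgrad : Continuous (∇ u) :=
    (InnerProductSpace.toDual ℝ (EuclideanSpace ℝ (Fin N))).symm.continuous.comp hDu
  have hng (x) : ‖∇ u x‖ = ‖fderiv ℝ u x‖ := by simp [gradient]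
  set c : ℝ := ((N : ℝ) - 2) / 2 with hc
  have hc0 : c ≠ 0 := by
    have : (3 : ℝ) ≤ N := by exact_mod_cast hN
    rw [hc]; intro h; linarith
  let G : EuclideanSpace ℝ (Fin N) → EuclideanSpace ℝ (Fin N) :=
    fun x => ∇ u x + (c * (u x / ‖x‖ ^ 2)) • x
  have hG (x) : ‖G x‖ ^ 2 = ‖fderiv ℝ u x‖ ^ 2 +
      (c * fderiv ℝ (fun x => u x ^ 2 / ‖x‖ ^ 2) x x +
        (2 * c + c ^ 2) * (u x ^ 2 / ‖x‖ ^ 2)) := by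
    rw [norm_add_sq_real, hng, inner_smul_right, inner_gradient_left, norm_smul, mul_pow,
      Real.norm_eq_abs, sq_abs, fderiv_sq_div_norm_sq_apply_self (hd x)
        (hw.differentiable one_ne_zero x)]
    have : (u x / ‖x‖ ^ 2) ^ 2 * ‖x‖ ^ 2 = u x ^ 2 / ‖x‖ ^ 2 := by
      rcases eq_or_ne x 0 with rfl | hx
      · simp
      · have : ‖x‖ ≠ 0 := by simpa using hx
        field_simp
    linear_combination c ^ 2 * this
  have hGc : HasCompactSupport fun x => ‖G x‖ ^ 2 := by
    refine hcs.mono' fun x hx => ?_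
    by_contra hxu
    have h1 : u x = 0 := image_eq_zero_of_notMem_tsupport hxu
    have h2 : fderiv ℝ u x = 0 :=
      image_eq_zero_of_notMem_tsupport fun h => hxu (tsupport_fderiv_subset ℝ h)
    exact hx (by simp [G, h1, gradient, h2])
  have hpos : 0 < ∫ x, ‖G x‖ ^ 2 := by
    obtain ⟨x, hux, hx⟩ := exists_ne_zero_fderiv_eq_zero hd hcs hu
    have hx0 : x ≠ 0 := hsupp (subset_tsupport u hux)
    refine Continuous.integral_pos_of_hasCompactSupport_nonneg_nonzero (x := x)
      (by fun_prop) hGc (fun x => by positivity) ?_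
    simp [G, gradient, hx, hc0, hux, hx0]
  have hDw : Continuous fun x => fderiv ℝ (fun x => u x ^ 2 / ‖x‖ ^ 2) x x :=
    (hw.continuous_fderiv one_ne_zero).clm_apply continuous_id
  have hDwi : Integrable fun x => fderiv ℝ (fun x => u x ^ 2 / ‖x‖ ^ 2) x x :=
    hDw.integrable_of_hasCompactSupport <| (hwc.fderiv ℝ).mono fun x hx h => hx (by simp [h])
  have hDui : Integrable fun x => ‖fderiv ℝ u x‖ ^ 2 :=
    Continuous.integrable_of_hasCompactSupport (by fun_prop) <|
      (hcs.fderiv ℝ).mono fun x (hx : ‖fderiv ℝ u x‖ ^ 2 ≠ 0) h => hx (by simp [h])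
  have hwi : Integrable fun x => u x ^ 2 / ‖x‖ ^ 2 :=
    hw.continuous.integrable_of_hasCompactSupport hwc
  simp_rw [hG] at hpos
  rw [integral_add hDui (by fun_prop),
    integral_add (hDwi.const_mul c) (hwi.const_mul _), integral_const_mul, integral_const_mul,
    integral_fderiv_apply_self hw hwc] at hpos
  rw [hc] at hpos
  linarith
end

section
/- Let N ≥ 2 be a natural number and let ν ∈ ℝ. Suppose u : (0,∞) → ℝ is twice differentiable, u(r) > 0 for all r > 0, and u satisfies the Euler equidimensional equation u''(r) + ((N−1)/r) u'(r) + (ν/r²) u(r) = 0 for all r ∈ (0,∞). Then ν ≤ (N−2)²/4. -/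
open MeasureTheory Filter Topology

/-- The Riccati equation `z' = -(z² + c)` has no global solution when `c > 0`. -/
theorem riccati_global_solution_nonpos {c : ℝ} {z : ℝ → ℝ}
    (hz : ∀ t, HasDerivAt z (-(z t ^ 2 + c)) t) : c ≤ 0 := by
  by_contra! hc
  obtain ⟨ω, hω, rfl⟩ : ∃ ω : ℝ, 0 < ω ∧ c = ω ^ 2 :=
    ⟨√c, Real.sqrt_pos.2 hc, (Real.sq_sqrt hc.le).symm⟩
  have hg : ∀ t, HasDerivAt (fun t => Real.arctan (z t / ω) + ω * t) 0 t := by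
    intro t
    refine (((hz t).div_const ω).arctan.add ((hasDerivAt_id t).const_mul ω)).congr_deriv ?_
    have : 0 < ω ^ 2 + z t ^ 2 := by positivity
    field_simp
    ring
  have hconst := is_const_of_deriv_eq_zero (fun t => (hg t).differentiableAt)
    (fun t => (hg t).deriv) (Real.pi / ω) 0
  have hπ : ω * (Real.pi / ω) = Real.pi := by field_simp
  simp only [hπ, mul_zero, add_zero] at hconst
  linarith [Real.neg_pi_div_two_lt_arctan (z (Real.pi / ω) / ω),
    Real.arctan_lt_pi_div_two (z 0 / ω)]

/-- **Positive solutions of the Euler equidimensional equation.** If the equation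
`u'' + ((N−1)/r) u' + (ν/r²) u = 0` admits a global positive solution on `(0,∞)`, then
`ν ≤ (N−2)²/4`. -/
theorem euler_equation_positive_solution_constraint
    (N : ℕ) (hN : 2 ≤ N) (ν : ℝ) (u u' u'' : ℝ → ℝ)
    (hd1 : ∀ r : ℝ, 0 < r → HasDerivAt u (u' r) r)
    (hd2 : ∀ r : ℝ, 0 < r → HasDerivAt u' (u'' r) r)
    (hpos : ∀ r : ℝ, 0 < r → 0 < u r)
    (heq : ∀ r : ℝ, 0 < r →
      u'' r + (((N : ℝ) - 1) / r) * u' r + (ν / r ^ 2) * u r = 0) :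
    ν ≤ ((N : ℝ) - 2) ^ 2 / 4 := by
  suffices h : ν - ((N : ℝ) - 2) ^ 2 / 4 ≤ 0 by linarith
  refine riccati_global_solution_nonpos
    (z := fun t => Real.exp t * u' (Real.exp t) / u (Real.exp t) + ((N : ℝ) - 2) / 2) fun t => ?_
  have hr := Real.exp_pos t
  have he := Real.hasDerivAt_exp t
  have hu := (hd1 _ hr).comp t he
  have hu' := (hd2 _ hr).comp t he
  have hp := hpos _ hr
  have h2 : u'' (Real.exp t) = -((((N : ℝ) - 1) / Real.exp t) * u' (Real.exp t) +
      (ν / Real.exp t ^ 2) * u (Real.exp t)) := by linarith [heq _ hr]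
  refine (((he.mul hu').div hu hp.ne').add_const (((N : ℝ) - 2) / 2)).congr_deriv ?_
  simp only [Function.comp_apply, Pi.mul_apply, h2]
  field_simp
  ring
end

section
/- Let N ≥ 3, let K ⊂ ℝ^N be a compact set, let p > N/2, and let V : ℝ^N → ℝ be nonnegative with V ∈ L^p(K). If (u_k) is a sequence of smooth functions with compact support in ℝ^N such that sup_k ∫_{ℝ^N} |∇u_k|² dx < ∞ and ∫_K u_k² dx → 0, then ∫_K V u_k² dx → 0. -/
open MeasureTheory Filter Topology

open scoped ENNReal NNReal

theorem ofReal_grad2 {N : ℕ} {u : EuclideanSpace ℝ (Fin N) → ℝ} (hu : ContDiff ℝ 1 u)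
    (hc : HasCompactSupport u) :
    ENNReal.ofReal (grad2 N u) = eLpNorm (fderiv ℝ u) 2 volume ^ 2 := by
  have hcont : Continuous (fderiv ℝ u) := hu.continuous_fderiv one_ne_zero
  have hint : Integrable (fun x => ‖fderiv ℝ u x‖ ^ 2) :=
    (hcont.memLp_of_hasCompactSupport (p := 2) (hc.fderiv (𝕜 := ℝ))).integrable_norm_pow (by simp)
  have h := eLpNorm_nnreal_pow_eq_lintegral (f := fderiv ℝ u) (p := 2)
    (μ := (volume : Measure (EuclideanSpace ℝ (Fin N)))) two_ne_zero
  norm_num at h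
  rw [h, grad2, ofReal_integral_eq_lintegral_ofReal hint (ae_of_all _ fun x => by positivity)]
  congr! with x
  rw [ENNReal.ofReal_pow (norm_nonneg _), ofReal_norm]

/-- **Sobolev inequality** in terms of the Dirichlet energy. -/
theorem exists_lintegral_enorm_rpow_le_of_grad2_le {N : ℕ} (hN : 3 ≤ N) (C : ℝ) :
    ∃ M : ℝ≥0∞, M ≠ ⊤ ∧ ∀ u : EuclideanSpace ℝ (Fin N) → ℝ, ContDiff ℝ 1 u →
      HasCompactSupport u → grad2 N u ≤ C →
        ∫⁻ x, ‖u x‖ₑ ^ (2 * N / (N - 2) : ℝ) ≤ M := by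
  have hN' : (3 : ℝ) ≤ N := by exact_mod_cast hN
  have hq : (0 : ℝ) < 2 * N / (N - 2) := div_pos (by linarith) (by linarith)
  let q : ℝ≥0 := ⟨2 * N / (N - 2), hq.le⟩
  have hq0 : q ≠ 0 := fun h => hq.ne' (congrArg NNReal.toReal h)
  refine ⟨(eLpNormLESNormFDerivOfEqInnerConst
    (volume : Measure (EuclideanSpace ℝ (Fin N))) ((2 : ℝ≥0) : ℝ) *
      ENNReal.ofReal C ^ (1 / 2 : ℝ)) ^ (q : ℝ), by finiteness, fun u hu hc hC => ?_⟩
  have hS := eLpNorm_le_eLpNorm_fderiv_of_eq_inner (volume : Measure (EuclideanSpace ℝ (Fin N)))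
    hu hc (p := 2) (p' := q) one_le_two (by simp; omega) (by
      rw [show (q : ℝ) = 2 * N / (N - 2) from rfl, finrank_euclideanSpace_fin]
      push_cast
      have : (N : ℝ) - 2 ≠ 0 := by linarith
      have : (N : ℝ) ≠ 0 := by linarith
      field_simp)
  have hG : eLpNorm (fderiv ℝ u) 2 volume ≤ ENNReal.ofReal C ^ (1 / 2 : ℝ) := by
    rw [one_div, ENNReal.le_rpow_inv_iff two_pos, ENNReal.rpow_ofNat, ← ofReal_grad2 hu hc]
    exact ENNReal.ofReal_le_ofReal hC
  have h := eLpNorm_nnreal_pow_eq_lintegral (f := u)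
    (μ := (volume : Measure (EuclideanSpace ℝ (Fin N)))) hq0
  calc ∫⁻ x, ‖u x‖ₑ ^ (2 * N / (N - 2) : ℝ) = eLpNorm u q volume ^ (q : ℝ) := h.symm
    _ ≤ _ := by
      gcongr
      exact hS.trans (by gcongr; exact_mod_cast hG)

/-- Hölder's inequality interpolating `∫ V u²` between `∫ Vᵖ`, `∫ u²` and `∫ |u| ^ (2n / (n - 2))`. -/
theorem lintegral_mul_sq_le {α : Type*} [MeasurableSpace α] {μ : Measure α} {V u : α → ℝ≥0∞}
    (hV : AEMeasurable V μ) (hu : AEMeasurable u μ) {n p : ℝ} (hn : 2 < n) (hp : n / 2 < p) :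
    ∫⁻ x, V x * u x ^ 2 ∂μ ≤ (∫⁻ x, V x ^ p ∂μ) ^ (1 / p) *
      (∫⁻ x, u x ^ 2 ∂μ) ^ (1 - n / (2 * p)) *
        (∫⁻ x, u x ^ (2 * n / (n - 2)) ∂μ) ^ ((n - 2) / (2 * p)) := by
  have hp0 : 0 < p := by linarith
  have hn2 : 0 < n - 2 := by linarith
  have hb : 0 < 1 - n / (2 * p) := by
    rw [sub_pos, div_lt_one (by positivity)]; linarith
  have hc : 0 < (n - 2) / (2 * p) := by positivity
  have h := ENNReal.lintegral_prod_norm_pow_le (μ := μ) Finset.univ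
    (f := ![fun x => V x ^ p, fun x => u x ^ 2, fun x => u x ^ (2 * n / (n - 2))])
    (p := ![1 / p, 1 - n / (2 * p), (n - 2) / (2 * p)])
    (by
      intro i _
      fin_cases i
      · exact hV.pow_const _
      · exact hu.pow_const _
      · exact hu.pow_const _)
    (by simp [Fin.sum_univ_three]; field_simp; ring)
    (by
      intro i _
      fin_cases i
      · exact (one_div_pos.2 hp0).le
      · exact hb.le
      · exact hc.le)
  simp only [Fin.prod_univ_three, Matrix.cons_val] at h
  convert h using 3 with x
  rw [← ENNReal.rpow_mul, mul_one_div_cancel hp0.ne', ENNReal.rpow_one, mul_assoc,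
    ← ENNReal.rpow_ofNat, ← ENNReal.rpow_mul, ← ENNReal.rpow_mul,
    ← ENNReal.rpow_add_of_nonneg _ _ (by positivity) (by positivity)]
  congr 2
  field_simp
  ring

/-- **Local compactness of the potential term.** If `V ∈ Lᵖ(K)` with `p > N/2` on a
compact set `K`, and `u_k` have bounded Dirichlet energy with `∫_K u_k² → 0`, then
`∫_K V u_k² → 0`. -/
theorem potential_term_vanishes_on_compact
    (N : ℕ) (hN : 3 ≤ N) (K : Set (EuclideanSpace ℝ (Fin N))) (hK : IsCompact K)
    (p : ℝ) (hp : (N : ℝ) / 2 < p)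
    (V : EuclideanSpace ℝ (Fin N) → ℝ) (hV0 : ∀ x, 0 ≤ V x)
    (hVp : IntegrableOn (fun x => V x ^ p) K)
    (u : ℕ → EuclideanSpace ℝ (Fin N) → ℝ)
    (hsm : ∀ k, ContDiff ℝ (⊤ : ℕ∞) (u k)) (hcs : ∀ k, HasCompactSupport (u k))
    (hbd : ∃ C : ℝ, ∀ k, grad2 N (u k) ≤ C)
    (hL2 : Tendsto (fun k => ∫ x in K, u k x ^ 2) atTop (𝓝 0)) :
    Tendsto (fun k => ∫ x in K, V x * u k x ^ 2) atTop (𝓝 0) := by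
  have hN' : (3 : ℝ) ≤ N := by exact_mod_cast hN
  have hp0 : 0 < p := by linarith
  have hb : 0 < 1 - (N : ℝ) / (2 * p) := by
    rw [sub_pos, div_lt_one (by positivity)]; linarith
  obtain ⟨C, hC⟩ := hbd
  obtain ⟨M, hM, hMu⟩ := exists_lintegral_enorm_rpow_le_of_grad2_le hN C
  have hsm1 : ∀ k, ContDiff ℝ 1 (u k) := fun k => (hsm k).of_le (by exact_mod_cast le_top)
  have hVm : AEMeasurable V (volume.restrict K) := by
    have h := hVp.aestronglyMeasurable.aemeasurable.pow_const (1 / p)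
    refine h.congr (ae_of_all _ fun x => ?_)
    simp only [one_div]
    exact Real.rpow_rpow_inv (hV0 x) hp0.ne'
  have hVfin : ∫⁻ x in K, ‖V x‖ₑ ^ p ≠ ⊤ := by
    refine ne_of_eq_of_ne (lintegral_congr fun x => ?_) hVp.hasFiniteIntegral.ne
    rw [Real.enorm_rpow_of_nonneg (hV0 x) hp0.le]
  have hsq : Tendsto (fun k => ∫⁻ x in K, ‖u k x‖ₑ ^ 2) atTop (𝓝 0) := by
    have h := ENNReal.tendsto_ofReal hL2
    rw [ENNReal.ofReal_zero] at h
    refine h.congr fun k => ?_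
    have hint : IntegrableOn (fun x => u k x ^ 2) K :=
      ((hsm k).continuous.pow 2).continuousOn.integrableOn_compact hK
    rw [ofReal_integral_eq_lintegral_ofReal hint (ae_of_all _ fun x => sq_nonneg _)]
    refine lintegral_congr fun x => ?_
    rw [← enorm_pow, Real.enorm_of_nonneg (sq_nonneg _)]
  have hlim : Tendsto (fun k => ∫⁻ x in K, ‖V x‖ₑ * ‖u k x‖ₑ ^ 2) atTop (𝓝 0) := by
    have hfac : Tendsto (fun k => (∫⁻ x in K, ‖V x‖ₑ ^ p) ^ (1 / p) *
        (∫⁻ x in K, ‖u k x‖ₑ ^ 2) ^ (1 - N / (2 * p)) * M ^ (((N : ℝ) - 2) / (2 * p)))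
        atTop (𝓝 0) := by
      have h1 := (ENNReal.continuous_rpow_const (y := 1 - N / (2 * p))).tendsto 0 |>.comp hsq
      rw [ENNReal.zero_rpow_of_pos hb] at h1
      have h2 := ENNReal.Tendsto.const_mul (a := (∫⁻ x in K, ‖V x‖ₑ ^ p) ^ (1 / p)) h1
        (Or.inr (ENNReal.rpow_ne_top_of_nonneg (by positivity) hVfin))
      have h3 := ENNReal.Tendsto.mul_const (b := M ^ (((N : ℝ) - 2) / (2 * p))) h2
        (Or.inr (ENNReal.rpow_ne_top_of_nonneg (div_nonneg (by linarith) (by linarith)) hM))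
      simpa using h3
    refine tendsto_of_tendsto_of_tendsto_of_le_of_le tendsto_const_nhds hfac
      (fun _ => zero_le) fun k => ?_
    refine (lintegral_mul_sq_le hVm.enorm (hsm k).continuous.measurable.enorm.aemeasurable
      (by linarith) hp).trans ?_
    gcongr
    · exact div_nonneg (by linarith) (by linarith)
    · exact (setLIntegral_le_lintegral _ _).trans (hMu _ (hsm1 k) (hcs k) (hC k))
  have h := (ENNReal.tendsto_toReal ENNReal.zero_ne_top).comp hlim
  rw [ENNReal.toReal_zero] at h
  refine h.congr fun k => ?_
  rw [integral_eq_lintegral_of_nonneg_ae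
    (ae_of_all _ fun x => mul_nonneg (hV0 x) (sq_nonneg _))
    (hVm.mul ((hsm k).continuous.measurable.pow_const 2).aemeasurable).aestronglyMeasurable]
  simp only [Function.comp_apply]
  congr 1
  refine lintegral_congr fun x => ?_
  rw [← enorm_pow, ← enorm_mul, Real.enorm_of_nonneg (mul_nonneg (hV0 x) (sq_nonneg _))]
end
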